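/- arXiv:2107.06124 — 2 statements merged into one kernel-verified Lean document; each statement's English description precedes it below -/
import Mathlib

section
/- (Mean-zero property of the nonparametric influence function of the overlap-weighted estimand.) Let Y and A be bounded random variables, g₀(L) a σ(L)-measurable version of E[A | σ(L)], and r₀(L) a σ(L)-measurable version of E[Y | σ(L)]. Assume D := E[(A − g₀(L)) A] ≠ 0 and define θ* := E[(A − g₀(L)) Y] / D. Then E[(A − g₀(L)) A] = E[(A − g₀(L))²] and E[(A − g₀(L)) {Y − θ*(A − g₀(L)) − r₀(L)}] = 0. -/
open MeasureTheory

/-- A square-integrable residual `X - E[X | m]` is orthogonal to square-integrable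
`m`-measurable functions. -/
theorem integral_sub_condExp_mul_eq_zero {Ω : Type*} {m m₀ : MeasurableSpace Ω}
    {μ : Measure[m₀] Ω} [IsFiniteMeasure μ] (hm : m ≤ m₀) {X g f : Ω → ℝ}
    (hX : MemLp X 2 μ) (hg : g =ᵐ[μ] μ[X|m]) (hfm : StronglyMeasurable[m] f)
    (hf : MemLp f 2 μ) : ∫ ω, (X ω - g ω) * f ω ∂μ = 0 := by
  have hg2 : MemLp g 2 μ := (memLp_congr_ae hg).2 (.condExp one_le_two hX)
  have hXf : Integrable (X * f) μ := hX.integrable_mul hf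
  have hgf : Integrable (g * f) μ := hg2.integrable_mul hf
  have hpull : g * f =ᵐ[μ] μ[X * f|m] :=
    (hg.mul .rfl).trans
      (condExp_mul_of_stronglyMeasurable_right hfm hXf (hX.integrable one_le_two)).symm
  have heq : ∫ ω, (g * f) ω ∂μ = ∫ ω, (X * f) ω ∂μ := by
    rw [integral_congr_ae hpull, integral_condExp hm]
  calc ∫ ω, (X ω - g ω) * f ω ∂μ = ∫ ω, ((X * f) ω - (g * f) ω) ∂μ := by
        simp only [Pi.mul_apply, sub_mul]
    _ = 0 := by rw [integral_sub hXf hgf, heq, sub_self]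

/-- Mean-zero property of the nonparametric influence function of the
overlap-weighted estimand: E[(A − g₀(L))A] = E[(A − g₀(L))²] and
E[(A − g₀(L)){Y − θ*(A − g₀(L)) − r₀(L)}] = 0, where θ* = E[(A − g₀)Y]/E[(A − g₀)A]. -/
theorem overlap_weighted_influence_mean_zero
    {Ω : Type*} [𝓕 : MeasurableSpace Ω] {μ : Measure Ω} [IsProbabilityMeasure μ]
    (𝓛 : MeasurableSpace Ω) (h𝓛𝓕 : 𝓛 ≤ 𝓕)
    (Y A : Ω → ℝ)
    (hYmeas : Measurable[𝓕] Y) (hAmeas : Measurable[𝓕] A)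
    (CY : ℝ) (hYbd : ∀ ω, |Y ω| ≤ CY)
    (CA : ℝ) (hAbd : ∀ ω, |A ω| ≤ CA)
    (g₀ : Ω → ℝ) (hg₀meas : StronglyMeasurable[𝓛] g₀)
    (hg₀ : g₀ =ᵐ[μ] μ[A|𝓛])
    (r₀ : Ω → ℝ) (hr₀meas : StronglyMeasurable[𝓛] r₀)
    (hr₀ : r₀ =ᵐ[μ] μ[Y|𝓛])
    (hD : ∫ ω, (A ω - g₀ ω) * A ω ∂μ ≠ 0)
    (θstar : ℝ)
    (hθstar : θstar = (∫ ω, (A ω - g₀ ω) * Y ω ∂μ) / ∫ ω, (A ω - g₀ ω) * A ω ∂μ) :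
    (∫ ω, (A ω - g₀ ω) * A ω ∂μ = ∫ ω, (A ω - g₀ ω) ^ 2 ∂μ)
    ∧ ∫ ω, (A ω - g₀ ω) * (Y ω - θstar * (A ω - g₀ ω) - r₀ ω) ∂μ = 0 := by
  have hY : MemLp Y 2 μ := .of_bound hYmeas.aestronglyMeasurable CY (.of_forall hYbd)
  have hA : MemLp A 2 μ := .of_bound hAmeas.aestronglyMeasurable CA (.of_forall hAbd)
  have hg : MemLp g₀ 2 μ := (memLp_congr_ae hg₀).2 (.condExp one_le_two hA)
  have hr : MemLp r₀ 2 μ := (memLp_congr_ae hr₀).2 (.condExp one_le_two hY)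
  have hAg : MemLp (fun ω ↦ A ω - g₀ ω) 2 μ := hA.sub hg
  have horth_g : ∫ ω, (A ω - g₀ ω) * g₀ ω ∂μ = 0 :=
    integral_sub_condExp_mul_eq_zero h𝓛𝓕 hA hg₀ hg₀meas hg
  have horth_r : ∫ ω, (A ω - g₀ ω) * r₀ ω ∂μ = 0 :=
    integral_sub_condExp_mul_eq_zero h𝓛𝓕 hA hg₀ hr₀meas hr
  have hiA : Integrable (fun ω ↦ (A ω - g₀ ω) * A ω) μ := hAg.integrable_mul hA
  have hig : Integrable (fun ω ↦ (A ω - g₀ ω) * g₀ ω) μ := hAg.integrable_mul hg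
  have hiY : Integrable (fun ω ↦ (A ω - g₀ ω) * Y ω) μ := hAg.integrable_mul hY
  have hir : Integrable (fun ω ↦ (A ω - g₀ ω) * r₀ ω) μ := hAg.integrable_mul hr
  have hsq : ∫ ω, (A ω - g₀ ω) * A ω ∂μ = ∫ ω, (A ω - g₀ ω) ^ 2 ∂μ := by
    simp only [sq, mul_sub (_ - _)]
    rw [integral_sub hiA hig, horth_g, sub_zero]
  refine ⟨hsq, ?_⟩
  calc ∫ ω, (A ω - g₀ ω) * (Y ω - θstar * (A ω - g₀ ω) - r₀ ω) ∂μ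
      = ∫ ω, ((A ω - g₀ ω) * Y ω - θstar * (A ω - g₀ ω) ^ 2 - (A ω - g₀ ω) * r₀ ω) ∂μ := by
        congr 1 with ω
        ring
    _ = ∫ ω, (A ω - g₀ ω) * Y ω ∂μ - θstar * ∫ ω, (A ω - g₀ ω) ^ 2 ∂μ := by
        have hi2 := hAg.integrable_sq.const_mul θstar
        rw [integral_sub (by exact hiY.sub hi2) hir, integral_sub hiY hi2, integral_const_mul, horth_r,
          sub_zero]
    _ = 0 := by rw [← hsq, hθstar, div_mul_cancel₀ _ hD, sub_self]
end

section
/- (Drift of the doubly robust score when the partially linear model fails.) Let Y and A be bounded random variables, g₀(L) a σ(L)-measurable version of E[A | σ(L)], assume D := E[(A − g₀(L)) A] ≠ 0, and define θ* := E[(A − g₀(L)) Y] / D. Let q(L) be a σ(L)-measurable version of E[Y − θ*A | σ(L)]. Then for any bounded σ(L)-measurable functions ĝ(L) and m̂(L), E[(A − ĝ(L))(Y − θ*A − m̂(L))] = E[(g₀(L) − ĝ(L)) {q(L) − m̂(L)}]. -/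
open MeasureTheory

/-- A square-integrable `m`-measurable weight does not distinguish a random variable from a version
of its conditional expectation given `m`. -/
theorem integral_mul_eq_integral_mul_of_ae_eq_condExp
    {Ω : Type*} {m m₀ : MeasurableSpace Ω} {μ : Measure Ω} [IsFiniteMeasure μ] (hm : m ≤ m₀)
    {f h h' : Ω → ℝ} (hfm : StronglyMeasurable[m] f) (hf : MemLp f 2 μ) (hh : MemLp h 2 μ)
    (hh' : h' =ᵐ[μ] μ[h|m]) :
    ∫ ω, f ω * h ω ∂μ = ∫ ω, f ω * h' ω ∂μ := by
  have pull_out : μ[f * h|m] =ᵐ[μ] f * μ[h|m] :=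
    condExp_mul_of_stronglyMeasurable_left hfm (hf.integrable_mul hh) (hh.integrable one_le_two)
  calc ∫ ω, f ω * h ω ∂μ = ∫ ω, (μ[f * h|m]) ω ∂μ := (integral_condExp hm).symm
    _ = ∫ ω, f ω * h' ω ∂μ := by
      refine integral_congr_ae ?_
      filter_upwards [pull_out, hh'] with ω h₁ h₂
      rw [h₁, h₂, Pi.mul_apply]

theorem integral_sub_mul_sub
    {Ω : Type*} {m₀ : MeasurableSpace Ω} {μ : Measure Ω} {a b c d : Ω → ℝ}
    (ha : MemLp a 2 μ) (hb : MemLp b 2 μ) (hc : MemLp c 2 μ) (hd : MemLp d 2 μ) :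
    ∫ ω, (a ω - b ω) * (c ω - d ω) ∂μ
      = ∫ ω, a ω * c ω ∂μ - ∫ ω, b ω * c ω ∂μ - ∫ ω, d ω * a ω ∂μ + ∫ ω, b ω * d ω ∂μ := by
  have hac : Integrable (fun ω => a ω * c ω) μ := ha.integrable_mul hc
  have hbc : Integrable (fun ω => b ω * c ω) μ := hb.integrable_mul hc
  have hda : Integrable (fun ω => d ω * a ω) μ := hd.integrable_mul ha
  have hbd : Integrable (fun ω => b ω * d ω) μ := hb.integrable_mul hd
  have hsub : Integrable (fun ω => a ω * c ω - b ω * c ω) μ := hac.sub hbc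
  have hsub' : Integrable (fun ω => a ω * c ω - b ω * c ω - d ω * a ω) μ := hsub.sub hda
  rw [← integral_sub hac hbc, ← integral_sub hsub hda, ← integral_add hsub' hbd]
  congr 1 with ω
  ring

/-- The overlap-weighted coefficient makes the residual `Y - θ * A` orthogonal to `A - g`. -/
theorem integral_mul_overlap_residual
    {Ω : Type*} {m₀ : MeasurableSpace Ω} {μ : Measure Ω} {Y A g : Ω → ℝ} {θ : ℝ}
    (hY : MemLp Y 2 μ) (hA : MemLp A 2 μ) (hg : MemLp g 2 μ)
    (hD : ∫ ω, (A ω - g ω) * A ω ∂μ ≠ 0)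
    (hθ : θ = (∫ ω, (A ω - g ω) * Y ω ∂μ) / ∫ ω, (A ω - g ω) * A ω ∂μ) :
    ∫ ω, A ω * (Y ω - θ * A ω) ∂μ = ∫ ω, g ω * (Y ω - θ * A ω) ∂μ := by
  have hR : MemLp (fun ω => Y ω - θ * A ω) 2 μ := hY.sub (hA.const_mul θ)
  have hAY : Integrable (fun ω => (A ω - g ω) * Y ω) μ := (hA.sub hg).integrable_mul hY
  have hAA : Integrable (fun ω => (A ω - g ω) * A ω) μ := (hA.sub hg).integrable_mul hA
  have hAR : Integrable (fun ω => A ω * (Y ω - θ * A ω)) μ := hA.integrable_mul hR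
  have hgR : Integrable (fun ω => g ω * (Y ω - θ * A ω)) μ := hg.integrable_mul hR
  rw [← sub_eq_zero, ← integral_sub hAR hgR]
  calc ∫ ω, A ω * (Y ω - θ * A ω) - g ω * (Y ω - θ * A ω) ∂μ
      = ∫ ω, (A ω - g ω) * Y ω - θ * ((A ω - g ω) * A ω) ∂μ := by
        congr 1 with ω
        ring
    _ = ∫ ω, (A ω - g ω) * Y ω ∂μ - θ * ∫ ω, (A ω - g ω) * A ω ∂μ := by
        rw [integral_sub hAY (hAA.const_mul θ), integral_const_mul]
    _ = 0 := by rw [hθ, div_mul_cancel₀ _ hD, sub_self]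

/-- Drift of the doubly robust score when the partially linear model
fails: E[(A − ĝ(L))(Y − θ*A − m̂(L))] = E[(g₀(L) − ĝ(L)){q(L) − m̂(L)}], where
θ* is the overlap-weighted estimand and q(L) is a version of E[Y − θ*A | σ(L)]. -/
theorem model_free_drift_identity
    {Ω : Type*} [𝓕 : MeasurableSpace Ω] {μ : Measure Ω} [IsProbabilityMeasure μ]
    (𝓛 : MeasurableSpace Ω) (h𝓛𝓕 : 𝓛 ≤ 𝓕)
    (Y A : Ω → ℝ)
    (hYmeas : Measurable[𝓕] Y) (hAmeas : Measurable[𝓕] A)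
    (CY : ℝ) (hYbd : ∀ ω, |Y ω| ≤ CY)
    (CA : ℝ) (hAbd : ∀ ω, |A ω| ≤ CA)
    (g₀ : Ω → ℝ) (hg₀meas : StronglyMeasurable[𝓛] g₀)
    (hg₀ : g₀ =ᵐ[μ] μ[A|𝓛])
    (hD : ∫ ω, (A ω - g₀ ω) * A ω ∂μ ≠ 0)
    (θstar : ℝ)
    (hθstar : θstar = (∫ ω, (A ω - g₀ ω) * Y ω ∂μ) / ∫ ω, (A ω - g₀ ω) * A ω ∂μ)
    (q : Ω → ℝ) (hqmeas : StronglyMeasurable[𝓛] q)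
    (hq : q =ᵐ[μ] μ[(fun ω => Y ω - θstar * A ω)|𝓛])
    (ghat mhat : Ω → ℝ)
    (hghatmeas : StronglyMeasurable[𝓛] ghat) (Cg : ℝ) (hghatbd : ∀ ω, |ghat ω| ≤ Cg)
    (hmhatmeas : StronglyMeasurable[𝓛] mhat) (Cmh : ℝ) (hmhatbd : ∀ ω, |mhat ω| ≤ Cmh) :
    ∫ ω, (A ω - ghat ω) * (Y ω - θstar * A ω - mhat ω) ∂μ
      = ∫ ω, (g₀ ω - ghat ω) * (q ω - mhat ω) ∂μ := by
  have hY : MemLp Y 2 μ := .of_bound hYmeas.aestronglyMeasurable CY (ae_of_all _ hYbd)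
  have hA : MemLp A 2 μ := .of_bound hAmeas.aestronglyMeasurable CA (ae_of_all _ hAbd)
  have hR : MemLp (fun ω => Y ω - θstar * A ω) 2 μ := hY.sub (hA.const_mul θstar)
  have hg : MemLp g₀ 2 μ := (memLp_congr_ae hg₀).2 (hA.condExp one_le_two)
  have hqL : MemLp q 2 μ := (memLp_congr_ae hq).2 (hR.condExp one_le_two)
  have hgh : MemLp ghat 2 μ :=
    .of_bound (hghatmeas.mono h𝓛𝓕).aestronglyMeasurable Cg (ae_of_all _ hghatbd)
  have hmh : MemLp mhat 2 μ :=
    .of_bound (hmhatmeas.mono h𝓛𝓕).aestronglyMeasurable Cmh (ae_of_all _ hmhatbd)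
  rw [integral_sub_mul_sub hA hgh hR hmh, integral_sub_mul_sub hg hgh hqL hmh,
    integral_mul_overlap_residual hY hA hg hD hθstar,
    integral_mul_eq_integral_mul_of_ae_eq_condExp h𝓛𝓕 hg₀meas hg hR hq,
    integral_mul_eq_integral_mul_of_ae_eq_condExp h𝓛𝓕 hghatmeas hgh hR hq,
    integral_mul_eq_integral_mul_of_ae_eq_condExp h𝓛𝓕 hmhatmeas hmh hA hg₀]
end
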